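/- Let K and L be languages over a finite alphabet Σ accepted by an m-state alternating finite automaton and an n-state alternating finite automaton, respectively. Then the union K ∪ L is accepted by an alternating finite automaton with at most m + n + 1 states. Moreover, for all m, n ≥ 2 there exist languages K and L over a one-letter alphabet accepted by an m-state and an n-state alternating finite automaton, respectively, such that every alternating finite automaton accepting K ∪ L has at least m + n + 1 states. -/

import Mathlib

/-- A Boolean finite automaton (BFA): `δ` maps each state and symbol to a
Boolean function in the state variables, `g` is the initial Boolean function,
and `accept` is the finality (characteristic) vector of the final state set. -/
structure BFA (α : Type) (σ : Type) where
  δ : σ → α → (σ → Bool) → Bool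
  g : (σ → Bool) → Bool
  accept : σ → Bool

namespace BFA

variable {α σ : Type}

/-- One-symbol action on Boolean functions: `(h·a)(v) = h (fun q => δ q a v)`. -/
def stepFn (A : BFA α σ) (h : (σ → Bool) → Bool) (a : α) : (σ → Bool) → Bool :=
  fun v => h fun q => A.δ q a v

/-- Action of a string on the initial function: `g·ε = g`, `g·(wa) = (g·w)·a`. -/
def eval (A : BFA α σ) (w : List α) : (σ → Bool) → Bool :=
  w.foldl A.stepFn A.g

/-- The language of a BFA: strings whose resulting Boolean function
evaluates to `true` on the finality vector. -/
def language (A : BFA α σ) : Language α :=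
  { w | A.eval w A.accept = true }

/-- A BFA is alternating (an AFA) if its initial function is a projection. -/
def IsAFA (A : BFA α σ) : Prop :=
  ∃ q₀ : σ, A.g = fun v => v q₀

end BFA

/-- `L` is accepted by some `n`-state BFA. -/
def AcceptsBFA {α : Type} (L : Language α) (n : ℕ) : Prop :=
  ∃ (σ : Type) (_ : Fintype σ), Fintype.card σ = n ∧ ∃ A : BFA α σ, A.language = L

/-- `L` is accepted by some `n`-state AFA. -/
def AcceptsAFA {α : Type} (L : Language α) (n : ℕ) : Prop :=
  ∃ (σ : Type) (_ : Fintype σ), Fintype.card σ = n ∧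
    ∃ A : BFA α σ, A.IsAFA ∧ A.language = L

/-- `L` is accepted by some `n`-state DFA. -/
def AcceptsDFA {α : Type} (L : Language α) (n : ℕ) : Prop :=
  ∃ (σ : Type) (_ : Fintype σ), Fintype.card σ = n ∧ ∃ D : DFA α σ, D.accepts = L

/-- `L` is accepted by some `n`-state NFA with a unique initial state. -/
def AcceptsNFA1 {α : Type} (L : Language α) (n : ℕ) : Prop :=
  ∃ (σ : Type) (_ : Fintype σ), Fintype.card σ = n ∧
    ∃ (M : NFA α σ) (q₀ : σ), M.start = {q₀} ∧ M.accepts = L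

/-- The reversal of a language. -/
def Language.rev {α : Type} (L : Language α) : Language α :=
  { w | w.reverse ∈ L }

namespace BFA

variable {α σ τ : Type}

/-- The vector of values of the states after reading `w` backwards from the finality vector. -/
def config (A : BFA α σ) (w : List α) : σ → Bool :=
  w.foldr (fun a v q => A.δ q a v) A.accept

theorem config_cons (A : BFA α σ) (a : α) (w : List α) :
    A.config (a :: w) = fun q => A.δ q a (A.config w) := rfl

theorem eval_accept (A : BFA α σ) (w : List α) : A.eval w A.accept = A.g (A.config w) := by
  have key : ∀ (w : List α) (h : (σ → Bool) → Bool),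
      w.foldl A.stepFn h A.accept = h (A.config w) := by
    intro w
    induction w with
    | nil => intro h; rfl
    | cons a w ih => intro h; rw [List.foldl_cons, ih]; rfl
  exact key w A.g

theorem mem_language (A : BFA α σ) {w : List α} :
    w ∈ A.language ↔ A.g (A.config w) = true := by
  rw [← eval_accept]
  rfl

/-- The union of two AFAs with initial states `p` and `q`; the fresh state `none` computes the
disjunction of `p` and `q`. -/
def union (A : BFA α σ) (B : BFA α τ) (p : σ) (q : τ) : BFA α (Option (σ ⊕ τ)) where
  δ
    | none, a, v => A.δ p a (fun s => v (some (.inl s))) || B.δ q a (fun t => v (some (.inr t)))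
    | some (.inl s), a, v => A.δ s a (fun s => v (some (.inl s)))
    | some (.inr t), a, v => B.δ t a (fun t => v (some (.inr t)))
  g v := v none
  accept
    | none => A.accept p || B.accept q
    | some (.inl s) => A.accept s
    | some (.inr t) => B.accept t

theorem config_union (A : BFA α σ) (B : BFA α τ) (p : σ) (q : τ) (w : List α) :
    (∀ s, (A.union B p q).config w (some (.inl s)) = A.config w s) ∧
    (∀ t, (A.union B p q).config w (some (.inr t)) = B.config w t) ∧
    (A.union B p q).config w none = (A.config w p || B.config w q) := by
  induction w with
  | nil => exact ⟨fun _ => rfl, fun _ => rfl, rfl⟩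
  | cons a w ih =>
    obtain ⟨h₁, h₂, -⟩ := ih
    simp only [config_cons]
    simp only [union] at h₁ h₂ ⊢
    simp [h₁, h₂]

theorem config_eq_iterate (A : BFA (Fin 1) σ) (w : List (Fin 1)) :
    A.config w = (fun v q => A.δ q 0 v)^[w.length] A.accept := by
  induction w with
  | nil => rfl
  | cons a w ih =>
    rw [config_cons, List.length_cons, Function.iterate_succ_apply', ← ih, Subsingleton.elim a 0]

end BFA

theorem AcceptsAFA.union {α : Type} {K L : Language α} {m n : ℕ}
    (hK : AcceptsAFA K m) (hL : AcceptsAFA L n) : AcceptsAFA (K ⊔ L) (m + n + 1) := by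
  obtain ⟨σ, _, hσ, A, ⟨p, hp⟩, rfl⟩ := hK
  obtain ⟨τ, _, hτ, B, ⟨q, hq⟩, rfl⟩ := hL
  refine ⟨Option (σ ⊕ τ), inferInstance, by simp [hσ, hτ], A.union B p q, ⟨none, rfl⟩, ?_⟩
  ext w
  have hmem : w ∈ A.language ⊔ B.language ↔ w ∈ A.language ∨ w ∈ B.language := Iff.rfl
  have hg : (A.union B p q).g = fun v => v none := rfl
  rw [hmem, BFA.mem_language, BFA.mem_language, BFA.mem_language, hg, hp, hq]
  simp [(BFA.config_union A B p q w).2.2]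

/-- The unary language of words whose length modulo `M` is less than `c`. -/
def modLtLanguage (M c : ℕ) : Language (Fin 1) :=
  { w | w.length % M < c }

theorem acceptsAFA_modLtLanguage {M c k : ℕ} (hM : 0 < M) (hc : c ≤ 2 ^ k)
    (hMc : M ≤ c + 2 ^ k) : AcceptsAFA (modLtLanguage M c) (k + 1) := by
  let code : ℕ → Option (Fin k) → Bool := fun i q =>
    q.elim (decide (i < c)) fun j => (if i < c then i else i - c).testBit j
  have testBit_inj : ∀ x y : ℕ, x < 2 ^ k → y < 2 ^ k →
      (∀ j : Fin k, x.testBit j = y.testBit j) → x = y := by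
    intro x y hx hy h
    refine Nat.eq_of_testBit_eq fun j => ?_
    by_cases hj : j < k
    · exact h ⟨j, hj⟩
    · have hk : 2 ^ k ≤ 2 ^ j := Nat.pow_le_pow_right (by norm_num) (not_lt.mp hj)
      rw [Nat.testBit_lt_two_pow (hx.trans_le hk), Nat.testBit_lt_two_pow (hy.trans_le hk)]
  have code_inj : Set.InjOn code (Set.Iio M) := by
    intro x hx y hy h
    rw [Set.mem_Iio] at hx hy
    have h₀ : (x < c) ↔ (y < c) := by simpa [code] using congrFun h none
    have h₁ := testBit_inj (if x < c then x else x - c) (if y < c then y else y - c)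
      (by split_ifs <;> omega) (by split_ifs <;> omega) fun j => congrFun h (some j)
    split_ifs at h₁ <;> omega
  let A : BFA (Fin 1) (Option (Fin k)) :=
    { δ := fun q _ v => code ((Function.invFunOn code (Set.Iio M) v + 1) % M) q
      g := fun v => v none
      accept := code 0 }
  have config_eq : ∀ w, A.config w = code (w.length % M) := by
    intro w
    induction w with
    | nil => simp [BFA.config, A]
    | cons a w ih =>
      rw [BFA.config_cons, ih]
      have hinv := code_inj.leftInvOn_invFunOn (Set.mem_Iio.mpr (Nat.mod_lt w.length hM))
      simp only [A, hinv, Nat.mod_add_mod, List.length_cons]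
  refine ⟨Option (Fin k), inferInstance, by simp, A, ⟨none, rfl⟩, ?_⟩
  ext w
  rw [BFA.mem_language, config_eq]
  exact decide_eq_true_iff

theorem dvd_of_forall_le_mod {M c d : ℕ} (hc : 0 < c) (hcM : c < M)
    (h : ∀ x, c ≤ x % M → c ≤ (x + d) % M) : M ∣ d := by
  have hM : 0 < M := hc.trans hcM
  have hmul : ∀ j x, c ≤ x % M → c ≤ (x + j * d) % M := by
    intro j
    induction j with
    | zero => simp
    | succ j ih => intro x hx; rw [Nat.succ_mul, ← add_assoc]; exact h _ (ih x hx)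
  rw [Nat.dvd_iff_mod_eq_zero]
  by_contra hr
  have hrM : d % M < M := Nat.mod_lt d hM
  have hneg : ((M - 1) * d) % M = M - d % M := by
    have hsum : (M - d % M + d) % M = ((M - 1) * d + d) % M := by
      have h₁ : (M - 1) * d + d = M * d := by
        rw [← Nat.succ_mul, Nat.succ_eq_add_one, Nat.sub_add_cancel hM]
      have h₂ : M - d % M + d = M * (d / M + 1) := by
        have := Nat.div_add_mod d M
        rw [Nat.mul_add]
        omega
      rw [h₁, h₂, Nat.mul_mod_right, Nat.mul_mod_right]
    have hmod : M - d % M ≡ (M - 1) * d [MOD M] := Nat.ModEq.add_right_cancel' d hsum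
    rw [← hmod, Nat.mod_eq_of_lt (by omega)]
  have hge : c ≤ M - d % M := by
    have h₁ := hmul (M - 1) (M - 1) (by rw [Nat.mod_eq_of_lt] <;> omega)
    rw [Nat.add_mod, hneg, Nat.mod_eq_of_lt (a := M - 1) (by omega),
      show M - 1 + (M - d % M) = M - d % M - 1 + M by omega, Nat.add_mod_right,
      Nat.mod_eq_of_lt (by omega)] at h₁
    omega
  have h₂ := h (M - d % M) (by rwa [Nat.mod_eq_of_lt (by omega)])
  rw [Nat.add_mod, Nat.mod_eq_of_lt (a := M - d % M) (by omega),
    Nat.sub_add_cancel hrM.le, Nat.mod_self] at h₂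
  omega

theorem dvd_of_union_periodic {M N c e d : ℕ} (hMN : M.Coprime N) (hc : 0 < c) (hcM : c < M)
    (heN : e < N)
    (h : ∀ t, (t + d) % M < c ∨ (t + d) % N < e → t % M < c ∨ t % N < e) : M ∣ d := by
  refine dvd_of_forall_le_mod hc hcM fun x hx => ?_
  by_contra! hlt
  obtain ⟨t, ht₁, ht₂⟩ := Nat.chineseRemainder hMN x e
  have hU := h t (Or.inl (by rwa [ht₁.add_right d]))
  rw [ht₁, ht₂, Nat.mod_eq_of_lt heN] at hU
  omega

theorem le_card_filter_union {M N c e : ℕ} (hMN : M.Coprime N) :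
    M * N ≤ ((Finset.range (M * N)).filter fun t => t % M < c ∨ t % N < e).card
      + (M - c) * (N - e) := by
  set U := fun t => t % M < c ∨ t % N < e
  have hcompl : ((Finset.range (M * N)).filter fun t => ¬ U t).card ≤ (M - c) * (N - e) := by
    rw [← Nat.card_Ico c M, ← Nat.card_Ico e N, ← Finset.card_product]
    refine Finset.card_le_card_of_injOn (fun t => (t % M, t % N)) ?_ ?_
    · intro t ht
      simp only [U, Finset.coe_filter, Finset.mem_range, Set.mem_ofPred_eq, not_or, not_lt] at ht
      have hpos : 0 < M * N := by omega
      simp [ht.2, Nat.mod_lt _ (Nat.pos_of_mul_pos_right hpos),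
        Nat.mod_lt _ (Nat.pos_of_mul_pos_left hpos)]
    · intro s hs t ht hst
      simp only [Finset.coe_filter, Finset.mem_range, Set.mem_ofPred_eq] at hs ht
      have := (Nat.modEq_and_modEq_iff_modEq_mul hMN).mp (Prod.ext_iff.mp hst)
      exact this.eq_of_lt_of_lt hs.1 ht.1
  have hsum := Finset.card_filter_add_card_filter_not (s := Finset.range (M * N)) U
  rw [Finset.card_range] at hsum
  change _ ≤ ((Finset.range (M * N)).filter U).card + _
  omega

theorem card_filter_le_of_acceptsAFA {L : Language (Fin 1)} {k P : ℕ} {U : ℕ → Prop}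
    [DecidablePred U] (hU : ∀ w, w ∈ L ↔ U w.length) (hper : ∀ t, U (t + P) ↔ U t)
    (hmin : ∀ d, (∀ t, U (t + d) → U t) → P ∣ d) (hL : AcceptsAFA L k) :
    0 < k ∧ ((Finset.range P).filter U).card ≤ 2 ^ (k - 1) := by
  classical
  obtain ⟨σ, _, rfl, A, ⟨q₀, hg⟩, rfl⟩ := hL
  refine ⟨Fintype.card_pos_iff.mpr ⟨q₀⟩, ?_⟩
  set f : (σ → Bool) → σ → Bool := fun v q => A.δ q 0 v
  have hUf : ∀ t, U t ↔ (f^[t] A.accept) q₀ = true := by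
    intro t
    have := hU (List.replicate t 0)
    rw [BFA.mem_language, hg, BFA.config_eq_iterate, List.length_replicate] at this
    exact this.symm
  have hperMul : ∀ j t, U (t + j * P) ↔ U t := by
    intro j
    induction j with
    | zero => simp
    | succ j ih => intro t; rw [Nat.succ_mul, ← add_assoc, hper, ih]
  have hne : ∀ i j, i < j → j < P → f^[i] A.accept ≠ f^[j] A.accept := by
    intro i j hij hj heq
    have hdvd : P ∣ j - i := by
      refine hmin _ fun t ht => ?_
      have hiP : i ≤ i * P := Nat.le_mul_of_pos_right i (by omega)
      rw [← hperMul i, hUf] at ht ⊢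
      have h₁ : t + (j - i) + i * P = (t + i * P - i) + j := by omega
      have h₂ : t + i * P = (t + i * P - i) + i := by omega
      rw [h₁, Function.iterate_add_apply, ← heq, ← Function.iterate_add_apply, ← h₂] at ht
      exact ht
    have := Nat.le_of_dvd (by omega) hdvd
    omega
  have hcard : Fintype.card ({q // q ≠ q₀} → Bool) = 2 ^ (Fintype.card σ - 1) := by
    simp [Fintype.card_subtype_compl]
  rw [← hcard, ← Finset.card_univ]
  refine Finset.card_le_card_of_injOn (fun t q => (f^[t] A.accept) q) (by simp) ?_
  intro i hi j hj hij
  simp only [Finset.coe_filter, Finset.mem_range, Set.mem_ofPred_eq] at hi hj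
  have heq : f^[i] A.accept = f^[j] A.accept := by
    funext q
    by_cases hq : q = q₀
    · rw [hq, (hUf i).mp hi.2, (hUf j).mp hj.2]
    · exact congrFun hij ⟨q, hq⟩
  rcases lt_trichotomy i j with h | h | h
  · exact absurd heq (hne i j h hj.1)
  · exact h
  · exact absurd heq.symm (hne j i h hi.1)

theorem le_of_acceptsAFA_modLtLanguage_sup {m n k : ℕ} (hn : 1 ≤ n)
    (h : AcceptsAFA (modLtLanguage (2 ^ (m + 1)) (2 ^ m) ⊔
      modLtLanguage (2 ^ (n + 1) - 1) (2 ^ n)) k) : m + n + 3 ≤ k := by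
  have ha : 1 ≤ 2 ^ m := Nat.one_le_two_pow
  have hb : 2 ≤ 2 ^ n := Nat.le_self_pow (by omega) 2
  have hM : 2 ^ (m + 1) = 2 * 2 ^ m := by ring
  have hN : 2 ^ (n + 1) = 2 * 2 ^ n := by ring
  have hcop : (2 ^ (m + 1)).Coprime (2 ^ (n + 1) - 1) := by
    refine Nat.Coprime.pow_left _ ?_
    rw [Nat.coprime_two_left, Nat.odd_iff]
    omega
  set M := 2 ^ (m + 1)
  set N := 2 ^ (n + 1) - 1 with hNdef
  obtain ⟨hk, hle⟩ := card_filter_le_of_acceptsAFA (P := M * N)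
    (U := fun t => t % M < 2 ^ m ∨ t % N < 2 ^ n) (fun w => Iff.rfl)
    (fun t => by simp [Nat.add_mod])
    (fun d hd => hcop.mul_dvd_of_dvd_of_dvd
      (dvd_of_union_periodic hcop (by omega) (by omega) (by omega) hd)
      (dvd_of_union_periodic hcop.symm (by omega) (by omega) (by omega)
        fun t => Or.symm ∘ hd t ∘ Or.symm)) h
  have hcount := le_card_filter_union (c := 2 ^ m) (e := 2 ^ n) hcop
  have hlt : 2 ^ (m + n + 1) < 2 ^ (k - 1) := by
    refine lt_of_lt_of_le ?_ hle
    have h₁ : M - 2 ^ m = 2 ^ m := by omega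
    obtain ⟨b, hb'⟩ : ∃ b, 2 ^ n = b + 2 := ⟨2 ^ n - 2, by omega⟩
    have h₂ : N - 2 ^ n = b + 1 := by omega
    have h₃ : N = 2 * b + 3 := by omega
    rw [h₁, h₂] at hcount
    have h₄ : M * N = 4 * (2 ^ m * b) + 6 * 2 ^ m := by rw [hM, h₃]; ring
    have h₅ : 2 ^ (m + n + 1) = 2 * (2 ^ m * b) + 4 * 2 ^ m := by
      rw [pow_succ, pow_add, hb']; ring
    have h₆ : 2 ^ m * (b + 1) = 2 ^ m * b + 2 ^ m := by ring
    omega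
  have := (Nat.pow_lt_pow_iff_right (by norm_num)).mp hlt
  omega

/-- Union on AFAs: the upper bound `m + n + 1` holds, and it is tight over a
unary alphabet for all `m, n ≥ 2`. (For languages, `⊔` is union.) -/
theorem afa_union_tight :
    (∀ (α : Type) [Fintype α] (K L : Language α) (m n : ℕ),
      AcceptsAFA K m → AcceptsAFA L n →
        ∃ k ≤ m + n + 1, AcceptsAFA (K ⊔ L) k) ∧
    ∀ m n : ℕ, 2 ≤ m → 2 ≤ n → ∃ K L : Language (Fin 1),
      AcceptsAFA K m ∧ AcceptsAFA L n ∧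
      ∀ k : ℕ, AcceptsAFA (K ⊔ L) k → m + n + 1 ≤ k := by
  refine ⟨fun α _ K L m n hK hL => ⟨m + n + 1, le_rfl, hK.union hL⟩, fun m n hm hn => ?_⟩
  obtain ⟨m, rfl⟩ : ∃ i, m = i + 1 := ⟨m - 1, by omega⟩
  obtain ⟨n, rfl⟩ : ∃ i, n = i + 1 := ⟨n - 1, by omega⟩
  have hN : 2 ^ (n + 1) = 2 * 2 ^ n := by ring
  have hb : 1 ≤ 2 ^ n := Nat.one_le_two_pow
  refine ⟨modLtLanguage (2 ^ (m + 1)) (2 ^ m), modLtLanguage (2 ^ (n + 1) - 1) (2 ^ n),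
    acceptsAFA_modLtLanguage (by positivity) le_rfl (by rw [pow_succ]; omega),
    acceptsAFA_modLtLanguage (by omega) le_rfl (by omega), fun k hk => ?_⟩
  have := le_of_acceptsAFA_modLtLanguage_sup (by omega) hk
  omega
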